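/- Let 1 < s < ∞ and let σ be a locally finite positive Borel measure on ℝ^n. Then there exist constants C₁, C₂, C₃ > 0 depending only on s such that for every family Λ = (λ_Q)_{Q∈𝒟} of nonnegative reals with λ_Q = 0 whenever σ(Q) = 0, one has A₁(Λ) ≤ C₁ A₂(Λ) ≤ C₂ A₃(Λ) ≤ C₃ A₁(Λ), where A₁(Λ) = ∫_{ℝ^n} (∑_{Q∈𝒟} (λ_Q/σ(Q)) χ_Q(x))^s dσ(x), A₂(Λ) = ∑_{Q∈𝒟} λ_Q ((1/σ(Q)) ∑_{Q'∈𝒟, Q'⊆Q} λ_{Q'})^{s−1}, and A₃(Λ) = ∫_{ℝ^n} sup_{Q∈𝒟, x∈Q} ((1/σ(Q)) ∑_{Q'∈𝒟, Q'⊆Q} λ_{Q'})^s dσ(x). -/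

import Mathlib

open MeasureTheory ENNReal Set
open scoped Classical ENNReal NNReal

noncomputable section

/-- We model `ℝ^n` as `EuclideanSpace ℝ (Fin n)`. -/
abbrev Euc (n : ℕ) := EuclideanSpace ℝ (Fin n)

/-- Indices `(k, m)` of dyadic cubes in `ℝ^n`. -/
abbrev DIdx (n : ℕ) := ℤ × (Fin n → ℤ)

/-- The dyadic cube with index `q = (k, m)`, namely `2^{-k}(m + [0,1)^n)`. -/
def dCube (n : ℕ) (q : DIdx n) : Set (Euc n) :=
  {x | ∀ i, (q.2 i : ℝ) ≤ (2:ℝ) ^ q.1 * x i ∧ (2:ℝ) ^ q.1 * x i < (q.2 i : ℝ) + 1}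

/-- The side length of the dyadic cube of index `q = (k, m)` is `2^{-k}`. -/
def sideLen (n : ℕ) (q : DIdx n) : ℝ := (2:ℝ) ^ (-q.1)

/-- Characteristic function of a dyadic cube, with values in `ℝ≥0∞`. -/
def ch (n : ℕ) (q : DIdx n) (x : Euc n) : ℝ≥0∞ := (dCube n q).indicator 1 x

/-- `K̄(Q)(x) = σ(Q)⁻¹ ∑_{Q' ⊆ Q} K(Q') σ(Q') χ_{Q'}(x)`.
(Since `σ(Q') ≤ σ(Q)` for `Q' ⊆ Q`, this is automatically `0` when `σ(Q) = 0`,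
by the convention `∞ · 0 = 0` in `ℝ≥0∞`.) -/
def Kbar (n : ℕ) (σ : Measure (Euc n)) (K : DIdx n → ℝ≥0∞) (q : DIdx n) (x : Euc n) : ℝ≥0∞ :=
  (σ (dCube n q))⁻¹ *
    ∑' q' : DIdx n, if dCube n q' ⊆ dCube n q then K q' * σ (dCube n q') * ch n q' x else 0

/-- `A₁(Λ) = ∫ (∑_Q (λ_Q/σ(Q)) χ_Q(x))^s dσ(x)` (with `λ_Q/σ(Q) = 0` when `σ(Q) = 0`,
which holds automatically since then `λ_Q = 0` and `0/0 = 0` in `ℝ≥0∞`). -/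
def A1 (n : ℕ) (σ : Measure (Euc n)) (Λ : DIdx n → ℝ≥0) (s : ℝ) : ℝ≥0∞ :=
  ∫⁻ x, (∑' Q : DIdx n, (Λ Q : ℝ≥0∞) / σ (dCube n Q) * ch n Q x) ^ s ∂σ

/-- `A₂(Λ) = ∑_Q λ_Q ((1/σ(Q)) ∑_{Q' ⊆ Q} λ_{Q'})^{s-1}`. -/
def A2 (n : ℕ) (σ : Measure (Euc n)) (Λ : DIdx n → ℝ≥0) (s : ℝ) : ℝ≥0∞ :=
  ∑' Q : DIdx n, (Λ Q : ℝ≥0∞) *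
    ((σ (dCube n Q))⁻¹ *
        ∑' Q' : DIdx n, if dCube n Q' ⊆ dCube n Q then (Λ Q' : ℝ≥0∞) else 0) ^ (s - 1)

/-- `A₃(Λ) = ∫ sup_{Q ∋ x} ((1/σ(Q)) ∑_{Q' ⊆ Q} λ_{Q'})^s dσ(x)`. -/
def A3 (n : ℕ) (σ : Measure (Euc n)) (Λ : DIdx n → ℝ≥0) (s : ℝ) : ℝ≥0∞ :=
  ∫⁻ x, (⨆ (Q : DIdx n) (_ : x ∈ dCube n Q),
      (σ (dCube n Q))⁻¹ *
        ∑' Q' : DIdx n, if dCube n Q' ⊆ dCube n Q then (Λ Q' : ℝ≥0∞) else 0) ^ s ∂σ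

theorem young_aux (p : ℝ) (hp : 1 < p) (a v : ℝ≥0) :
    p * a * (v:ℝ) ^ (p - 1) ≤ (a:ℝ) ^ p + (p - 1) * (v:ℝ) ^ p := by
  have hp0 : 0 < p := by linarith
  have hc : p.HolderConjugate (p / (p-1)) := Real.HolderConjugate.conjExponent hp
  have h := Real.young_inequality_of_nonneg a.coe_nonneg (b := (v:ℝ)^(p-1)) (by positivity) hc
  have e : ((v:ℝ)^(p-1))^(p/(p-1)) = (v:ℝ)^p := by
    rw [← Real.rpow_mul v.coe_nonneg]; congr 1; field_simp [show p - 1 ≠ 0 by linarith]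
  rw [e] at h
  have h2 := mul_le_mul_of_nonneg_left h hp0.le
  have h1 : p - 1 ≠ 0 := by linarith
  calc p * a * (v:ℝ) ^ (p - 1) = p * (a * (v:ℝ) ^ (p - 1)) := by ring
    _ ≤ _ := h2
    _ = _ := by field_simp

theorem step_aux (p : ℝ) (hp : 1 < p) (A c : ℝ≥0∞) :
    (A + c) ^ p ≤ A ^ p + ENNReal.ofReal p * (c * (A + c) ^ (p - 1)) := by
  have hp0 : 0 < p := by linarith
  have hp1 : 0 < p - 1 := by linarith
  have hpp : ENNReal.ofReal p ≠ 0 := by simpa using hp0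
  by_cases hA : A = ∞
  · simp [hA, hp0]
  by_cases hc : c = ∞
  · simp [hc, hp0, hp1, ENNReal.mul_top hpp]
  lift A to ℝ≥0 using hA
  lift c to ℝ≥0 using hc
  have h := young_aux p hp A (A + c)
  lift p to ℝ≥0 using hp0.le
  rw [ENNReal.ofReal_coe_nnreal, ← ENNReal.coe_add, ← ENNReal.coe_rpow_of_nonneg _ hp0.le,
    ← ENNReal.coe_rpow_of_nonneg _ hp0.le, ← ENNReal.coe_rpow_of_nonneg _ hp1.le]
  norm_cast
  rw [← NNReal.coe_le_coe]
  push_cast at h ⊢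
  by_cases hu : (A:ℝ) + c = 0
  · have : (A:ℝ) = 0 := by have := A.2; have := c.2; simp at *; linarith
    have h2 : (c:ℝ) = 0 := by linarith
    simp [this, h2]
  have e : ((A:ℝ) + c) ^ (p:ℝ) = ((A:ℝ)+c) * ((A:ℝ) + c) ^ ((p:ℝ)-1) := by
    rw [Real.rpow_sub_one hu]; field_simp
  set u := ((A:ℝ) + c) ^ ((p:ℝ)-1)
  rw [e] at h ⊢
  linarith

theorem step_aux2 (s : ℝ) (hs : 1 < s) (w v m G : ℝ≥0∞) (hvw : v ≤ w) (hw : w ≠ ∞)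
    (hG : v < w → w * m ≤ G) :
    w ^ s * m ≤ v ^ s * m + ENNReal.ofReal (s / (s-1)) * (G * (w ^ (s-1) - v ^ (s-1))) := by
  rcases hvw.eq_or_lt with rfl | hlt
  · simp
  have hs0 : 0 < s := by linarith
  have hs1 : 0 < s - 1 := by linarith
  have hv : v ≠ ∞ := ne_top_of_le_ne_top hw hvw
  have key : w ^ s ≤ v ^ s + ENNReal.ofReal (s / (s-1)) * (w * (w ^ (s-1) - v ^ (s-1))) := by
    lift w to ℝ≥0 using hw
    lift v to ℝ≥0 using hv
    have hvw' : v ≤ w := by exact_mod_cast hvw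
    have hmono : v ^ (s-1) ≤ w ^ (s-1) := NNReal.rpow_le_rpow hvw' hs1.le
    have h := young_aux s hs w v
    rw [← ENNReal.coe_rpow_of_nonneg _ hs0.le,
      ← ENNReal.coe_rpow_of_nonneg _ hs0.le, ← ENNReal.coe_rpow_of_nonneg _ hs1.le,
      ← ENNReal.coe_rpow_of_nonneg _ hs1.le, ENNReal.ofReal, ← ENNReal.coe_sub]
    norm_cast
    rw [← NNReal.coe_le_coe]
    push_cast [NNReal.coe_sub hmono]
    rw [Real.coe_toNNReal _ (by positivity)]
    have hw0 : (w:ℝ) ≠ 0 := by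
      have : v < w := by exact_mod_cast hlt
      have := (zero_le (a := v)).trans_lt this
      exact_mod_cast this.ne'
    have e : (w:ℝ) ^ s = w * (w:ℝ) ^ (s-1) := by
      rw [Real.rpow_sub_one hw0]; field_simp
    rw [e] at h ⊢
    set u := (w:ℝ) ^ (s-1)
    set t := (v:ℝ) ^ (s-1)
    set r := (v:ℝ) ^ s
    have : r + s / (s-1) * (w * (u - t)) - w * u = (((w * u) + (s-1) * r) - s * w * t) / (s-1) := by
      field_simp; ring
    have h3 : 0 ≤ (((w * u) + (s-1) * r) - s * w * t) / (s-1) := div_nonneg (by linarith) hs1.le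
    linarith
  calc w ^ s * m ≤ (v ^ s + ENNReal.ofReal (s / (s-1)) * (w * (w ^ (s-1) - v ^ (s-1)))) * m := by gcongr
    _ = v ^ s * m + ENNReal.ofReal (s / (s-1)) * ((w * m) * (w ^ (s-1) - v ^ (s-1))) := by ring
    _ ≤ _ := by gcongr; exact hG hlt

theorem discrete_aux {ι : Type*} (p : ℝ) (hp : 1 < p) (f : ι → ℤ) (c : ι → ℝ≥0∞) (T : Finset ι) :
    (∑ i ∈ T, c i) ^ p ≤
      ENNReal.ofReal p * ∑ i ∈ T, c i * (∑ j ∈ T with f j ≤ f i, c j) ^ (p - 1) := by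
  have hp1 : 0 < p - 1 := by linarith
  induction T using Finset.induction_on_max_value f with
  | empty => simp [show 0 < p by linarith]
  | insert a T ha hmax ih =>
    rw [Finset.sum_insert ha, Finset.sum_insert ha, add_comm]
    have e : (insert a T).filter (fun j => f j ≤ f a) = insert a T := by
      apply Finset.filter_true_of_mem
      intro x hx
      rcases Finset.mem_insert.1 hx with rfl | hx
      · exact le_rfl
      · exact hmax x hx
    rw [e, Finset.sum_insert ha, mul_add, add_comm (c a) (∑ i ∈ T, c i)]
    refine (step_aux p hp _ _).trans ?_
    rw [add_comm]
    gcongr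
    refine ih.trans ?_
    gcongr
    exact Finset.subset_insert _ _

theorem absorb_aux (X Y K : ℝ≥0∞) (t : ℝ) (ht : 0 < t) (hX : X ≠ ∞)
    (h : X ≤ K * (X ^ (1 - t) * Y ^ t)) : X ≤ K ^ (1 / t) * Y := by
  by_cases h0 : X = 0
  · simp [h0]
  have e : X ^ t ≤ K * Y ^ t := by
    have h1 : X ^ (1-t) ≠ 0 := by simp [ENNReal.rpow_eq_zero_iff, h0, hX]
    have h2 : X ^ (1-t) ≠ ∞ := by simp [ENNReal.rpow_eq_top_iff, h0, hX]
    rw [← ENNReal.mul_le_mul_iff_right h1 h2, ← ENNReal.rpow_add _ _ h0 hX]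
    simp only [sub_add_cancel, ENNReal.rpow_one]
    refine h.trans (le_of_eq (by ring))
  have := ENNReal.rpow_le_rpow e (z := 1 / t) (by positivity)
  rw [ENNReal.mul_rpow_of_nonneg _ _ (by positivity), ← ENNReal.rpow_mul, ← ENNReal.rpow_mul] at this
  simpa [ht.ne'] using this

section AbstractDyadic

variable {X ι : Type*} [MeasurableSpace X]

/-- finite localized sums -/
def sT (Q : ι → Set X) (Λ : ι → ℝ≥0∞) (T : Finset ι) (i : ι) : ℝ≥0∞ :=
  ∑ j ∈ T with Q j ⊆ Q i, Λ j

def aT (μ : Measure X) (Q : ι → Set X) (Λ : ι → ℝ≥0∞) (T : Finset ι) (i : ι) : ℝ≥0∞ :=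
  (μ (Q i))⁻¹ * sT Q Λ T i

def gT (μ : Measure X) (Q : ι → Set X) (Λ : ι → ℝ≥0∞) (i : ι) (x : X) : ℝ≥0∞ :=
  Λ i / μ (Q i) * (Q i).indicator 1 x

def fT (μ : Measure X) (Q : ι → Set X) (Λ : ι → ℝ≥0∞) (T : Finset ι) (x : X) : ℝ≥0∞ :=
  ∑ i ∈ T, gT μ Q Λ i x

def mT (Q : ι → Set X) (a : ι → ℝ≥0∞) (T : Finset ι) (x : X) : ℝ≥0∞ :=
  T.sup (fun i => (Q i).indicator (fun _ => a i) x)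

variable {μ : Measure X} {Q : ι → Set X} {Λ : ι → ℝ≥0∞} {f : ι → ℤ}

theorem gT_meas (hm : ∀ i, MeasurableSet (Q i)) (i : ι) : Measurable (gT μ Q Λ i) := by
  unfold gT
  exact (measurable_one.indicator (hm i)).const_mul _

theorem fT_meas (hm : ∀ i, MeasurableSet (Q i)) (T : Finset ι) : Measurable (fT μ Q Λ T) := by
  unfold fT
  exact Finset.measurable_fun_sum _ fun i _ => gT_meas hm i

theorem mT_meas (hm : ∀ i, MeasurableSet (Q i)) (a : ι → ℝ≥0∞) (T : Finset ι) :
    Measurable (mT Q a T) := by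
  unfold mT
  induction T using Finset.induction_on with
  | empty => simp
  | insert i T hi ih =>
    simp only [Finset.sup_insert]
    exact (measurable_const.indicator (hm i)).sup ih

theorem gT_lintegral (hm : ∀ i, MeasurableSet (Q i)) (hfin : ∀ i, μ (Q i) ≠ ∞)
    (h0 : ∀ i, μ (Q i) = 0 → Λ i = 0) (i : ι) : ∫⁻ x, gT μ Q Λ i x ∂μ = Λ i := by
  unfold gT
  rw [lintegral_const_mul _ (measurable_one.indicator (hm i)), lintegral_indicator_one (hm i)]
  by_cases h : μ (Q i) = 0
  · simp [h, h0 i h]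
  · exact ENNReal.div_mul_cancel h (hfin i)

theorem coef_ne_top (hΛ : ∀ i, Λ i ≠ ∞) (h0 : ∀ i, μ (Q i) = 0 → Λ i = 0) (i : ι) :
    Λ i / μ (Q i) ≠ ∞ := by
  by_cases h : μ (Q i) = 0
  · simp [h, h0 i h]
  · exact ENNReal.div_ne_top (hΛ i) h

theorem sT_ne_top (hΛ : ∀ i, Λ i ≠ ∞) (T : Finset ι) (i : ι) : sT Q Λ T i ≠ ∞ := by
  unfold sT
  exact ENNReal.sum_ne_top.2 fun j _ => hΛ j

theorem sT_zero (h0 : ∀ i, μ (Q i) = 0 → Λ i = 0) (T : Finset ι) (i : ι) (h : μ (Q i) = 0) :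
    sT Q Λ T i = 0 := by
  unfold sT
  refine Finset.sum_eq_zero fun j hj => h0 j ?_
  exact measure_mono_null (Finset.mem_filter.1 hj).2 h

theorem aT_ne_top (hΛ : ∀ i, Λ i ≠ ∞) (h0 : ∀ i, μ (Q i) = 0 → Λ i = 0)
    (T : Finset ι) (i : ι) : aT μ Q Λ T i ≠ ∞ := by
  unfold aT
  by_cases h : μ (Q i) = 0
  · simp [sT_zero h0 T i h]
  · exact ENNReal.mul_ne_top (by simpa using h) (sT_ne_top hΛ T i)

/-- The maximal function inequality, before Hölder. -/
theorem max_aux (hm : ∀ i, MeasurableSet (Q i))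
    (hN : ∀ i j x, x ∈ Q i → x ∈ Q j → f i ≤ f j → Q j ⊆ Q i)
    (s : ℝ) (hs : 1 < s) (a : ι → ℝ≥0∞) (ha : ∀ i, a i ≠ ∞) (G : X → ℝ≥0∞) (hG : Measurable G)
    (T : Finset ι) (haG : ∀ i, a i * μ (Q i) ≤ ∫⁻ x in Q i, G x ∂μ) :
    ∫⁻ x, (mT Q a T x) ^ s ∂μ ≤
      ENNReal.ofReal (s / (s-1)) * ∫⁻ x, G x * (mT Q a T x) ^ (s - 1) ∂μ := by
  have hs0 : 0 < s := by linarith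
  have hs1 : 0 < s - 1 := by linarith
  induction T using Finset.induction_on_max_value f with
  | empty => simp [mT, hs0]
  | insert i T hi hmax ih =>
    set v : ℝ≥0∞ := T.sup (fun j => if Q i ⊆ Q j then a j else 0) with hv
    have hvtop : v ≠ ∞ := by
      refine ((Finset.sup_lt_iff (by simp)).2 fun j _ => ?_).ne
      split_ifs
      · exact (ha j).lt_top
      · simp
    have hold : ∀ x ∈ Q i, mT Q a T x = v := by
      intro x hx
      unfold mT
      refine Finset.sup_congr rfl fun j hj => ?_
      by_cases h : x ∈ Q j
      · simp [h, hN j i x h hx (hmax j hj)]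
      · have : ¬ Q i ⊆ Q j := fun h' => h (h' hx)
        simp [h, this]
    set w := a i ⊔ v with hw
    have hnew : ∀ x ∈ Q i, mT Q a (insert i T) x = w := by
      intro x hx
      have := hold x hx
      unfold mT at this ⊢
      rw [Finset.sup_insert, this]
      simp [hx, hw]
    have hnew' : ∀ x ∈ (Q i)ᶜ, mT Q a (insert i T) x = mT Q a T x := by
      intro x hx
      unfold mT
      rw [Finset.sup_insert]
      have hx' : x ∉ Q i := hx
      simp [hx']
    have hwtop : w ≠ ∞ := by simp [hw, ha i, hvtop]
    rw [← lintegral_add_compl _ (hm i)] at ih ⊢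
    rw [← lintegral_add_compl (fun x => G x * (mT Q a T x) ^ (s - 1)) (hm i)] at ih
    rw [← lintegral_add_compl (fun x => G x * (mT Q a (insert i T) x) ^ (s - 1)) (hm i)]
    rw [setLIntegral_congr_fun (hm i) (f := fun x => (mT Q a T x) ^ s) (g := fun _ => v ^ s) (fun x hx => by simp only [hold x hx]),
      setLIntegral_congr_fun (f := fun x => G x * (mT Q a T x) ^ (s - 1)) (hm i)
        (g := fun x => G x * v ^ (s-1))
        (fun x hx => by simp only [hold x hx]), lintegral_mul_const _ hG, setLIntegral_const] at ih
    rw [setLIntegral_congr_fun (hm i) (f := fun x => (mT Q a (insert i T) x) ^ s) (g := fun _ => w ^ s) (fun x hx => by simp only [hnew x hx]),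
      setLIntegral_congr_fun (f := fun x => G x * (mT Q a (insert i T) x) ^ (s - 1)) (hm i)
        (g := fun x => G x * w ^ (s-1))
        (fun x hx => by simp only [hnew x hx]),
      setLIntegral_congr_fun (hm i).compl (f := fun x => (mT Q a (insert i T) x) ^ s)
        (g := fun x => (mT Q a T x) ^ s)
        (fun x hx => by simp only [hnew' x hx]),
      setLIntegral_congr_fun (f := fun x => G x * (mT Q a (insert i T) x) ^ (s - 1)) (hm i).compl
        (g := fun x => G x * (mT Q a T x) ^ (s-1))
        (fun x hx => by simp only [hnew' x hx]),
      lintegral_mul_const _ hG, setLIntegral_const]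
    have key := step_aux2 s hs w v (μ (Q i)) (∫⁻ x in Q i, G x ∂μ) le_sup_right hwtop (by
      intro hlt
      have : w = a i := by
        rcases le_total v (a i) with h | h
        · simp [hw, h]
        · simp [hw, h] at hlt
      rw [this]; exact haG i)
    set Gi := ∫⁻ x in Q i, G x ∂μ
    set P := ∫⁻ x in (Q i)ᶜ, (mT Q a T x) ^ s ∂μ
    set R := ∫⁻ x in (Q i)ᶜ, G x * (mT Q a T x) ^ (s-1) ∂μ
    set C := ENNReal.ofReal (s / (s-1))
    have hvw : v ^ (s-1) ≤ w ^ (s-1) := ENNReal.rpow_le_rpow le_sup_right hs1.le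
    calc w ^ s * μ (Q i) + P ≤ (v ^ s * μ (Q i) + C * (Gi * (w ^ (s-1) - v ^ (s-1)))) + P := by gcongr
      _ = (v ^ s * μ (Q i) + P) + C * (Gi * (w ^ (s-1) - v ^ (s-1))) := by ring
      _ ≤ C * (Gi * v ^ (s-1) + R) + C * (Gi * (w ^ (s-1) - v ^ (s-1))) := by gcongr
      _ = C * (Gi * ((w ^ (s-1) - v ^ (s-1)) + v ^ (s-1)) + R) := by ring
      _ = _ := by rw [tsub_add_cancel_of_le hvw]

theorem mT_fin (hm : ∀ i, MeasurableSet (Q i)) (hfin : ∀ i, μ (Q i) ≠ ∞)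
    (s : ℝ) (hs : 0 < s) (a : ι → ℝ≥0∞) (ha : ∀ i, a i ≠ ∞) (T : Finset ι) :
    ∫⁻ x, (mT Q a T x) ^ s ∂μ ≠ ∞ := by
  have hle : ∀ x, (mT Q a T x) ^ s ≤ ∑ i ∈ T, (Q i).indicator (fun _ => (a i) ^ s) x := by
    intro x
    unfold mT
    induction T using Finset.induction_on with
    | empty => simp [hs]
    | insert i T hi ih =>
      rw [Finset.sup_insert, Finset.sum_insert hi,
        (ENNReal.monotone_rpow_of_nonneg hs.le).map_sup]
      refine sup_le ?_ (ih.trans le_add_self)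
      refine le_trans ?_ le_self_add
      by_cases hx : x ∈ Q i <;> simp [hx, hs]
  refine ne_top_of_le_ne_top ?_ (lintegral_mono hle)
  rw [lintegral_finsetSum _ fun i _ => measurable_const.indicator (hm i)]
  refine ENNReal.sum_ne_top.2 fun i _ => ?_
  rw [lintegral_indicator_const (hm i)]
  exact ENNReal.mul_ne_top (ENNReal.rpow_ne_top_of_nonneg hs.le (ha i)) (hfin i)

theorem holder_aux (s : ℝ) (hs : 1 < s) (F M : X → ℝ≥0∞) (hF : Measurable F) (hM : Measurable M) :
    ∫⁻ x, F x * M x ^ (s-1) ∂μ ≤ (∫⁻ x, F x ^ s ∂μ) ^ (1/s) * (∫⁻ x, M x ^ s ∂μ) ^ (1 - 1/s) := by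
  have hs0 : 0 < s := by linarith
  have h := ENNReal.lintegral_mul_norm_pow_le (μ := μ) (f := fun x => F x ^ s)
    (g := fun x => M x ^ s) (hF.pow_const s).aemeasurable (hM.pow_const s).aemeasurable
    (p := 1/s) (q := 1 - 1/s) (by positivity)
    (by rw [sub_nonneg, div_le_one hs0]; exact hs.le) (by ring)
  refine le_trans (le_of_eq ?_) h
  refine lintegral_congr fun x => ?_
  rw [← ENNReal.rpow_mul, ← ENNReal.rpow_mul]
  congr 2
  · simp [hs0.ne']
  · field_simp

theorem fin_A3_le (hm : ∀ i, MeasurableSet (Q i)) (hfin : ∀ i, μ (Q i) ≠ ∞)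
    (hN : ∀ i j x, x ∈ Q i → x ∈ Q j → f i ≤ f j → Q j ⊆ Q i)
    (hΛ : ∀ i, Λ i ≠ ∞) (h0 : ∀ i, μ (Q i) = 0 → Λ i = 0)
    (s : ℝ) (hs : 1 < s) (T : Finset ι) :
    ∫⁻ x, (mT Q (aT μ Q Λ T) T x) ^ s ∂μ ≤
      ENNReal.ofReal (s / (s-1)) ^ s * ∫⁻ x, (fT μ Q Λ T x) ^ s ∂μ := by
  have hs0 : 0 < s := by linarith
  have h1 := max_aux (μ := μ) hm hN s hs (aT μ Q Λ T) (aT_ne_top hΛ h0 T) (fT μ Q Λ T)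
    (fT_meas hm T) T (by
      intro i
      have e1 : aT μ Q Λ T i * μ (Q i) ≤ sT Q Λ T i := by
        unfold aT
        rw [mul_right_comm]
        exact mul_le_of_le_one_left' (ENNReal.inv_mul_le_one _)
      refine e1.trans ?_
      unfold sT
      calc ∑ j ∈ T with Q j ⊆ Q i, Λ j
          = ∑ j ∈ T with Q j ⊆ Q i, ∫⁻ x in Q i, gT μ Q Λ j x ∂μ := by
            refine Finset.sum_congr rfl fun j hj => ?_
            rw [setLIntegral_eq_of_support_subset, gT_lintegral hm hfin h0]
            intro x hx
            apply (Finset.mem_filter.1 hj).2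
            by_contra hxx
            simp [gT, hxx] at hx
        _ = ∫⁻ x in Q i, ∑ j ∈ T with Q j ⊆ Q i, gT μ Q Λ j x ∂μ := by
            rw [lintegral_finsetSum _ fun i _ => gT_meas hm i]
        _ ≤ _ := by
            refine lintegral_mono fun x => ?_
            unfold fT
            exact Finset.sum_le_sum_of_subset (Finset.filter_subset _ _))
  have h2 := h1.trans (mul_le_mul_right (holder_aux (μ := μ) s hs (fT μ Q Λ T) _ (fT_meas hm T)
    (mT_meas hm (aT μ Q Λ T) T)) _)
  have h3 := absorb_aux _ (∫⁻ x, (fT μ Q Λ T x) ^ s ∂μ) (ENNReal.ofReal (s / (s-1))) (1/s)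
    (by positivity) (mT_fin hm hfin s hs0 _ (aT_ne_top hΛ h0 T) T) (h2.trans (le_of_eq (by ring)))
  simpa using h3

theorem fin_A1_le_small (hm : ∀ i, MeasurableSet (Q i)) (hfin : ∀ i, μ (Q i) ≠ ∞)
    (hN : ∀ i j x, x ∈ Q i → x ∈ Q j → f i ≤ f j → Q j ⊆ Q i)
    (h0 : ∀ i, μ (Q i) = 0 → Λ i = 0)
    (s : ℝ) (hs : 1 < s) (hs2 : s ≤ 2) (T : Finset ι) :
    ∫⁻ x, (fT μ Q Λ T x) ^ s ∂μ ≤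
      ENNReal.ofReal s * ∑ i ∈ T, Λ i * aT μ Q Λ T i ^ (s - 1) := by
  have hs1 : 0 < s - 1 := by linarith
  have hH : ∀ i, Measurable (fun x => ∑ j ∈ T with Q j ⊆ Q i, gT μ Q Λ j x) := fun i =>
    Finset.measurable_fun_sum _ fun i _ => gT_meas hm i
  have pt : ∀ x, (fT μ Q Λ T x) ^ s ≤ ENNReal.ofReal s * ∑ i ∈ T, Λ i / μ (Q i) *
      (Q i).indicator (fun x => (∑ j ∈ T with Q j ⊆ Q i, gT μ Q Λ j x) ^ (s-1)) x := by
    intro x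
    refine (discrete_aux s hs (fun i => - f i) (fun i => gT μ Q Λ i x) T).trans ?_
    refine mul_le_mul_right (Finset.sum_le_sum fun i hi => ?_) _
    by_cases hx : x ∈ Q i
    · simp only [gT, hx, indicator_of_mem, Pi.one_apply, mul_one]
      refine mul_le_mul_right (ENNReal.rpow_le_rpow ?_ hs1.le) _
      rw [Finset.sum_filter, Finset.sum_filter]
      refine Finset.sum_le_sum fun j _ => ?_
      by_cases hxj : x ∈ Q j
      · by_cases hf : f i ≤ f j
        · simp [hf, hN i j x hx hxj hf]
        · simp [hf]
      · simp [hxj]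
    · simp [gT, hx]
  refine (lintegral_mono pt).trans ?_
  have hM : ∀ i, Measurable ((Q i).indicator
      (fun x => (∑ j ∈ T with Q j ⊆ Q i, gT μ Q Λ j x) ^ (s-1))) := fun i =>
    ((hH i).pow_const _).indicator (hm i)
  rw [lintegral_const_mul _ (Finset.measurable_fun_sum _ fun i _ => (hM i).const_mul _),
    lintegral_finsetSum _ fun i _ => (hM i).const_mul _]
  gcongr with i hi
  rw [lintegral_const_mul _ (hM i), lintegral_indicator (hm i)]
  by_cases hz : μ (Q i) = 0
  · simp [h0 i hz]
  have j1 := ENNReal.lintegral_mul_norm_pow_le (μ := μ.restrict (Q i))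
    (f := fun x => ∑ j ∈ T with Q j ⊆ Q i, gT μ Q Λ j x) (g := fun _ => 1)
    (hH i).aemeasurable aemeasurable_const (p := s-1) (q := 2 - s) hs1.le (by linarith) (by ring)
  simp only [ENNReal.one_rpow, mul_one, lintegral_one, Measure.restrict_apply_univ] at j1
  have j2 : ∫⁻ x in Q i, ∑ j ∈ T with Q j ⊆ Q i, gT μ Q Λ j x ∂μ ≤ sT Q Λ T i := by
    refine (setLIntegral_le_lintegral _ _).trans (le_of_eq ?_)
    rw [lintegral_finsetSum _ fun i _ => gT_meas hm i]
    exact Finset.sum_congr rfl fun j _ => gT_lintegral hm hfin h0 j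
  calc Λ i / μ (Q i) * _ ≤ Λ i / μ (Q i) * (sT Q Λ T i ^ (s-1) * μ (Q i) ^ (2 - s)) := by
        gcongr
        refine j1.trans ?_
        gcongr
    _ = _ := by
        unfold aT
        rw [ENNReal.mul_rpow_of_nonneg _ _ hs1.le, ENNReal.inv_rpow,
          show 2 - s = 1 - (s - 1) by ring, ENNReal.rpow_sub _ _ hz (hfin i), ENNReal.rpow_one,
          div_eq_mul_inv, div_eq_mul_inv]
        calc _ = (μ (Q i) * (μ (Q i))⁻¹) * (Λ i * ((μ (Q i) ^ (s-1))⁻¹ * sT Q Λ T i ^ (s-1))) := by ring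
          _ = _ := by rw [ENNReal.mul_inv_cancel hz (hfin i), one_mul]

theorem fin_A1_le_large (hm : ∀ i, MeasurableSet (Q i)) (hfin : ∀ i, μ (Q i) ≠ ∞)
    (hN : ∀ i j x, x ∈ Q i → x ∈ Q j → f i ≤ f j → Q j ⊆ Q i)
    (hΛ : ∀ i, Λ i ≠ ∞) (h0 : ∀ i, μ (Q i) = 0 → Λ i = 0)
    (s : ℝ) (hs2 : 2 < s) (T : Finset ι) :
    ∫⁻ x, (fT μ Q Λ T x) ^ s ∂μ ≤
      ENNReal.ofReal s * (ENNReal.ofReal (s-1) ^ (s-1) * ∑ i ∈ T, Λ i * aT μ Q Λ T i ^ (s - 1)) := by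
  have hs : 1 < s := by linarith
  have hs1 : 0 < s - 1 := by linarith
  have hs3 : 0 < s - 2 := by linarith
  set c : ι → ℝ≥0∞ := fun i => Λ i / μ (Q i) with hc
  set U : ι → ℝ≥0∞ := fun i => ∑ j ∈ T with Q i ⊆ Q j, c j with hU
  have hUtop : ∀ i, U i ≠ ∞ := fun i => ENNReal.sum_ne_top.2 fun j _ => coef_ne_top hΛ h0 j
  set B := ∑ i ∈ T, Λ i * U i ^ (s-1) with hB
  have hBtop : B ≠ ∞ := ENNReal.sum_ne_top.2 fun j _ =>
    ENNReal.mul_ne_top (hΛ j) (ENNReal.rpow_ne_top_of_nonneg hs1.le (hUtop j))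
  have pt : ∀ x, (fT μ Q Λ T x) ^ s ≤ ENNReal.ofReal s * ∑ i ∈ T, gT μ Q Λ i x * U i ^ (s-1) := by
    intro x
    refine (discrete_aux s hs f (fun i => gT μ Q Λ i x) T).trans ?_
    refine mul_le_mul_right (Finset.sum_le_sum fun i hi => ?_) _
    by_cases hx : x ∈ Q i
    · gcongr
      simp only [hU]
      rw [Finset.sum_filter, Finset.sum_filter]
      refine Finset.sum_le_sum fun j _ => ?_
      by_cases hxj : x ∈ Q j
      · by_cases hf : f j ≤ f i
        · simp [gT, hf, hxj, hN j i x hxj hx hf, hc]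
        · simp [hf]
      · simp [gT, hxj]
    · simp [gT, hx]
  have A1B : ∫⁻ x, (fT μ Q Λ T x) ^ s ∂μ ≤ ENNReal.ofReal s * B := by
    refine (lintegral_mono pt).trans (le_of_eq ?_)
    rw [lintegral_const_mul _ (Finset.measurable_fun_sum _ fun i _ => (gT_meas hm i).mul_const _),
      lintegral_finsetSum _ fun i _ => (gT_meas hm i).mul_const _]
    congr 1
    refine Finset.sum_congr rfl fun i _ => ?_
    rw [lintegral_mul_const _ (gT_meas hm i), gT_lintegral hm hfin h0]
  have hB1 : B ≤ ENNReal.ofReal (s-1) * ∑ i ∈ T, Λ i * (aT μ Q Λ T i * U i ^ (s-2)) := by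
    have e1 : ∀ i ∈ T, Λ i * U i ^ (s-1) ≤
        ENNReal.ofReal (s-1) * ∑ j ∈ T, if Q i ⊆ Q j then Λ i * (c j * U j ^ (s-2)) else 0 := by
      intro i hi
      by_cases hz : μ (Q i) = 0
      · simp [h0 i hz]
      obtain ⟨x, hx⟩ : (Q i).Nonempty := nonempty_of_measure_ne_zero hz
      have d := discrete_aux (s-1) (by linarith) f c (T.filter (fun j => Q i ⊆ Q j))
      calc Λ i * U i ^ (s-1) ≤ Λ i * (ENNReal.ofReal (s-1) *
            ∑ j ∈ T with Q i ⊆ Q j, c j * U j ^ (s-2)) := by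
            gcongr
            refine d.trans ?_
            refine mul_le_mul_right (Finset.sum_le_sum fun j hj => ?_) _
            rw [show s - 1 - 1 = s - 2 by ring]
            refine mul_le_mul_right (ENNReal.rpow_le_rpow (Finset.sum_le_sum_of_subset ?_) hs3.le) _
            intro k hk
            simp only [Finset.mem_filter] at hk hj ⊢
            exact ⟨hk.1.1, hN k j x (hk.1.2 hx) (hj.2 hx) hk.2⟩
        _ = _ := by
            rw [mul_left_comm, Finset.mul_sum, Finset.sum_filter]
    refine (Finset.sum_le_sum e1).trans (le_of_eq ?_)
    rw [← Finset.mul_sum, Finset.sum_comm]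
    congr 1
    refine Finset.sum_congr rfl fun j _ => ?_
    rw [← Finset.sum_filter, ← Finset.sum_mul]
    simp only [hc, aT, sT, div_eq_mul_inv]
    ring
  set t := 1 / (s-1) with ht
  have hpq : (s-1).HolderConjugate ((s-1)/(s-2)) := by
    have := Real.HolderConjugate.conjExponent (p := s-1) (by linarith)
    rwa [Real.conjExponent, show s - 1 - 1 = s - 2 by ring] at this
  have hH := ENNReal.inner_le_Lp_mul_Lq T (fun i => Λ i ^ t * aT μ Q Λ T i)
    (fun i => Λ i ^ (1 - t) * U i ^ (s-2)) hpq
  have ht0 : 0 < t := by positivity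
  have ht1 : 0 ≤ 1 - t := by
    rw [sub_nonneg, ht, div_le_one hs1]; linarith
  have q1 : ∀ i, Λ i ^ t * aT μ Q Λ T i * (Λ i ^ (1 - t) * U i ^ (s-2)) =
      Λ i * (aT μ Q Λ T i * U i ^ (s-2)) := by
    intro i
    have : Λ i ^ t * Λ i ^ (1-t) = Λ i := by
      rw [← ENNReal.rpow_add_of_nonneg _ _ ht0.le ht1]; simp
    calc _ = (Λ i ^ t * Λ i ^ (1-t)) * (aT μ Q Λ T i * U i ^ (s-2)) := by ring
      _ = _ := by rw [this]
  have q2 : ∀ i, (Λ i ^ t * aT μ Q Λ T i) ^ (s-1) = Λ i * aT μ Q Λ T i ^ (s-1) := by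
    intro i
    rw [ENNReal.mul_rpow_of_nonneg _ _ hs1.le, ← ENNReal.rpow_mul, ht]
    simp [hs1.ne']
  have q3 : ∀ i, (Λ i ^ (1-t) * U i ^ (s-2)) ^ ((s-1)/(s-2)) = Λ i * U i ^ (s-1) := by
    intro i
    rw [ENNReal.mul_rpow_of_nonneg _ _ (by positivity), ← ENNReal.rpow_mul, ← ENNReal.rpow_mul, ht]
    have x1 : (1 - 1 / (s-1)) * ((s-1)/(s-2)) = 1 := by
      field_simp; ring
    have x2 : (s-2) * ((s-1)/(s-2)) = s - 1 := by field_simp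
    rw [x1, x2, ENNReal.rpow_one]
  simp only [q1, q2, q3] at hH
  have x3 : 1 / ((s-1)/(s-2)) = 1 - t := by rw [ht]; field_simp; ring
  rw [x3] at hH
  have hB2 := hB1.trans (mul_le_mul_right hH _)
  have hB3 := absorb_aux B (∑ i ∈ T, Λ i * aT μ Q Λ T i ^ (s-1)) (ENNReal.ofReal (s-1)) t ht0 hBtop
    (hB2.trans (le_of_eq (by rw [hB, ht]; ring)))
  rw [show 1 / t = s - 1 by rw [ht]; simp] at hB3
  exact A1B.trans (mul_le_mul_right hB3 _)

theorem fin_A2_le (hm : ∀ i, MeasurableSet (Q i)) (hfin : ∀ i, μ (Q i) ≠ ∞)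
    (hΛ : ∀ i, Λ i ≠ ∞) (h0 : ∀ i, μ (Q i) = 0 → Λ i = 0)
    (s : ℝ) (hs : 1 < s) (T : Finset ι) (C : ℝ≥0∞)
    (hC : ∫⁻ x, (fT μ Q Λ T x) ^ s ∂μ ≤ C * ∑ i ∈ T, Λ i * aT μ Q Λ T i ^ (s - 1)) :
    ∑ i ∈ T, Λ i * aT μ Q Λ T i ^ (s - 1) ≤
      (C ^ (1 / s)) ^ (1 / (1 - 1/s)) * ∫⁻ x, (mT Q (aT μ Q Λ T) T x) ^ s ∂μ := by
  have hs0 : 0 < s := by linarith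
  have hs1 : 0 < s - 1 := by linarith
  have ht : 0 < 1 - 1 / s := by rw [sub_pos, div_lt_one hs0]; exact hs
  refine absorb_aux _ _ _ _ ht ?_ ?_
  · exact ENNReal.sum_ne_top.2 fun j _ =>
      ENNReal.mul_ne_top (hΛ j) (ENNReal.rpow_ne_top_of_nonneg hs1.le (aT_ne_top hΛ h0 T j))
  calc ∑ i ∈ T, Λ i * aT μ Q Λ T i ^ (s - 1)
      = ∫⁻ x, ∑ i ∈ T, gT μ Q Λ i x * aT μ Q Λ T i ^ (s-1) ∂μ := by
        rw [lintegral_finsetSum _ fun i _ => (gT_meas hm i).mul_const _]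
        refine Finset.sum_congr rfl fun i _ => ?_
        rw [lintegral_mul_const _ (gT_meas hm i), gT_lintegral hm hfin h0]
    _ ≤ ∫⁻ x, fT μ Q Λ T x * (mT Q (aT μ Q Λ T) T x) ^ (s-1) ∂μ := by
        refine lintegral_mono fun x => ?_
        simp only [fT]
        rw [Finset.sum_mul]
        refine Finset.sum_le_sum fun i hi => ?_
        by_cases hx : x ∈ Q i
        · gcongr
          have := Finset.le_sup (f := fun i => (Q i).indicator (fun _ => aT μ Q Λ T i) x) hi
          simp only [hx, indicator_of_mem] at this
          exact this
        · simp [gT, hx]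
    _ ≤ _ := holder_aux s hs _ _ (fT_meas hm T) (mT_meas hm _ T)
    _ ≤ _ := by
        refine (mul_le_mul_left (ENNReal.rpow_le_rpow hC (by positivity)) _).trans (le_of_eq ?_)
        rw [ENNReal.mul_rpow_of_nonneg _ _ (by positivity), mul_assoc, _root_.sub_sub_cancel]

end AbstractDyadic

section Limits

variable {X ι : Type*} [MeasurableSpace X] [Countable ι]
variable {μ : Measure X} {Q : ι → Set X} {Λ : ι → ℝ≥0∞} {f : ι → ℤ}

def aInf (μ : Measure X) (Q : ι → Set X) (Λ : ι → ℝ≥0∞) (i : ι) : ℝ≥0∞ :=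
  (μ (Q i))⁻¹ * ∑' j, if Q j ⊆ Q i then Λ j else 0

theorem aT_mono (i : ι) : Monotone (fun T => aT μ Q Λ T i) := by
  intro T T' h
  simp only [aT, sT]
  gcongr

theorem aInf_eq (i : ι) : aInf μ Q Λ i = ⨆ T, aT μ Q Λ T i := by
  simp only [aInf, aT, sT]
  rw [ENNReal.tsum_eq_iSup_sum, ENNReal.mul_iSup]
  simp only [Finset.sum_filter]

theorem rpow_iSup_aux {κ : Type*} (s : ℝ) (hs : 0 < s) (g : κ → ℝ≥0∞) :
    (⨆ k, g k) ^ s = ⨆ k, g k ^ s :=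
  (ENNReal.orderIsoRpow s hs).map_iSup g

theorem lim_A1 (hm : ∀ i, MeasurableSet (Q i)) (s : ℝ) (hs : 1 < s) :
    ∫⁻ x, (∑' i, gT μ Q Λ i x) ^ s ∂μ = ⨆ T, ∫⁻ x, (fT μ Q Λ T x) ^ s ∂μ := by
  have hs0 : 0 < s := by linarith
  rw [← lintegral_iSup_directed]
  · refine lintegral_congr fun x => ?_
    rw [ENNReal.tsum_eq_iSup_sum, rpow_iSup_aux s hs0]
    rfl
  · exact fun T => ((fT_meas hm T).pow_const s).aemeasurable
  · refine Monotone.directed_le ?_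
    intro T T' h x
    simp only [fT]
    gcongr

theorem mT_mono : Monotone (fun T => mT Q (aT μ Q Λ T) T) := by
  intro T T' h x
  simp only [mT]
  refine Finset.sup_le fun i hi => ?_
  refine le_trans ?_ (Finset.le_sup (h hi))
  by_cases hx : x ∈ Q i
  · simpa [hx] using aT_mono i h
  · simp [hx]

theorem lim_A3 (hm : ∀ i, MeasurableSet (Q i)) (s : ℝ) (hs : 1 < s) :
    ∫⁻ x, (⨆ (i) (_ : x ∈ Q i), aInf μ Q Λ i) ^ s ∂μ =
      ⨆ T, ∫⁻ x, (mT Q (aT μ Q Λ T) T x) ^ s ∂μ := by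
  have hs0 : 0 < s := by linarith
  rw [← lintegral_iSup_directed]
  · refine lintegral_congr fun x => ?_
    rw [← rpow_iSup_aux s hs0]
    congr 1
    apply le_antisymm
    · refine iSup₂_le fun i hx => ?_
      rw [aInf_eq]
      refine iSup_le fun T => ?_
      refine le_trans (aT_mono i (Finset.subset_insert i T)) ?_
      refine le_trans ?_ (le_iSup _ (insert i T))
      have := Finset.le_sup (f := fun j => (Q j).indicator (fun _ => aT μ Q Λ (insert i T) j) x)
        (Finset.mem_insert_self i T)
      simp only [hx, indicator_of_mem] at this
      exact this
    · refine iSup_le fun T => Finset.sup_le fun i hi => ?_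
      by_cases hx : x ∈ Q i
      · simp only [hx, indicator_of_mem]
        refine le_trans ?_ (le_iSup₂ (f := fun i (_ : x ∈ Q i) => aInf μ Q Λ i) i hx)
        rw [aInf_eq]
        exact le_iSup (fun T => aT μ Q Λ T i) T
      · simp [hx]
  · exact fun T => ((mT_meas hm _ T).pow_const s).aemeasurable
  · refine Monotone.directed_le ?_
    intro T T' h x
    exact ENNReal.rpow_le_rpow (mT_mono h x) hs0.le

theorem lim_A2 (s : ℝ) (hs : 1 < s) :
    ∑' i, Λ i * aInf μ Q Λ i ^ (s-1) = ⨆ T, ∑ i ∈ T, Λ i * aT μ Q Λ T i ^ (s-1) := by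
  have hs1 : 0 < s - 1 := by linarith
  apply le_antisymm
  · rw [ENNReal.tsum_eq_iSup_sum]
    refine iSup_le fun U => ?_
    simp only [aInf_eq, rpow_iSup_aux _ hs1, ENNReal.mul_iSup]
    rw [ENNReal.finsetSum_iSup_of_monotone]
    · refine iSup_le fun T => ?_
      refine le_trans ?_ (le_iSup _ (U ∪ T))
      refine le_trans ?_ (Finset.sum_le_sum_of_subset (Finset.subset_union_left (s₂ := T)))
      refine Finset.sum_le_sum fun i _ => ?_
      exact mul_le_mul_right (ENNReal.rpow_le_rpow (aT_mono i Finset.subset_union_right) hs1.le) _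
    · intro i T T' h
      exact mul_le_mul_right (ENNReal.rpow_le_rpow (aT_mono i h) hs1.le) _
  · refine iSup_le fun T => ?_
    refine le_trans ?_ (ENNReal.sum_le_tsum T)
    refine Finset.sum_le_sum fun i _ => ?_
    refine mul_le_mul_right (ENNReal.rpow_le_rpow ?_ hs1.le) _
    rw [aInf_eq]
    exact le_iSup (fun T => aT μ Q Λ T i) T

end Limits

theorem dCube_meas (n : ℕ) (q : DIdx n) : MeasurableSet (dCube n q) := by
  unfold dCube
  rw [Set.setOf_forall]
  refine MeasurableSet.iInter fun i => ?_
  have h : Measurable (fun x : Euc n => (2:ℝ) ^ q.1 * x i) := by fun_prop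
  exact (measurableSet_le measurable_const h).inter (measurableSet_lt h measurable_const)

theorem dCube_fin (n : ℕ) (σ : Measure (Euc n)) [IsLocallyFiniteMeasure σ] (q : DIdx n) :
    σ (dCube n q) ≠ ∞ := by
  have hb : Bornology.IsBounded (dCube n q) := by
    have h1 : Bornology.IsBounded (Set.pi Set.univ (fun i : Fin n =>
        Set.Icc ((2:ℝ) ^ (-q.1) * q.2 i) ((2:ℝ) ^ (-q.1) * (q.2 i + 1)))) :=
      Bornology.IsBounded.pi fun i => Metric.isBounded_Icc _ _
    have h2 := (PiLp.lipschitzWith_toLp 2 (fun _ : Fin n => ℝ)).isBounded_image h1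
    refine h2.subset ?_
    intro x hx
    refine ⟨WithLp.ofLp x, ?_, by simp⟩
    intro i _
    have hp : (0:ℝ) < 2 ^ q.1 := by positivity
    obtain ⟨ha, hb⟩ := hx i
    rw [zpow_neg]
    constructor
    · rw [inv_mul_le_iff₀ hp]; exact ha
    · rw [le_inv_mul_iff₀ hp]; exact hb.le
  exact hb.measure_lt_top.ne

theorem dCube_nest (n : ℕ) (i j : DIdx n) (x : Euc n) (hi : x ∈ dCube n i) (hj : x ∈ dCube n j)
    (h : i.1 ≤ j.1) : dCube n j ⊆ dCube n i := by
  intro y hy l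
  obtain ⟨a1, a2⟩ := hi l
  obtain ⟨b1, b2⟩ := hj l
  obtain ⟨c1, c2⟩ := hy l
  obtain ⟨d, hd⟩ := Int.le.dest h
  have e : (2:ℝ) ^ j.1 = 2 ^ d * 2 ^ i.1 := by
    rw [← hd, zpow_add₀ two_ne_zero, zpow_natCast, mul_comm]
  rw [e, mul_assoc] at b1 b2 c1 c2
  have hD : (0:ℝ) < 2 ^ d := by positivity
  set D : ℝ := 2 ^ d with hDdef
  have k1 : i.2 l * 2 ^ d < j.2 l + 1 := by
    have : ((i.2 l * 2 ^ d : ℤ) : ℝ) < ((j.2 l + 1 : ℤ) : ℝ) := by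
      push_cast
      rw [← hDdef]
      nlinarith
    exact_mod_cast this
  have k2 : j.2 l < (i.2 l + 1) * 2 ^ d := by
    have : ((j.2 l : ℤ) : ℝ) < (((i.2 l + 1) * 2 ^ d : ℤ) : ℝ) := by
      push_cast
      rw [← hDdef]
      nlinarith
    exact_mod_cast this
  have k1' : (i.2 l : ℝ) * D ≤ j.2 l := by
    have := Int.lt_add_one_iff.1 k1
    have : ((i.2 l * 2 ^ d : ℤ) : ℝ) ≤ ((j.2 l : ℤ) : ℝ) := by exact_mod_cast this
    push_cast at this
    exact this
  have k2' : (j.2 l : ℝ) + 1 ≤ (i.2 l + 1) * D := by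
    have := Int.add_one_le_iff.2 k2
    have : ((j.2 l + 1 : ℤ) : ℝ) ≤ (((i.2 l + 1) * 2 ^ d : ℤ) : ℝ) := by exact_mod_cast this
    push_cast at this
    exact this
  constructor
  · by_contra hh
    push Not at hh
    nlinarith
  · by_contra hh
    push Not at hh
    nlinarith

theorem exists_D1 (s : ℝ) (hs : 1 < s) : ∃ D : ℝ≥0∞, D ≠ 0 ∧ D ≠ ∞ ∧
    ∀ {X ι : Type} [MeasurableSpace X] {μ : Measure X} {Q : ι → Set X} {Λ : ι → ℝ≥0∞} {f : ι → ℤ},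
    (∀ i, MeasurableSet (Q i)) → (∀ i, μ (Q i) ≠ ∞) →
    (∀ i j x, x ∈ Q i → x ∈ Q j → f i ≤ f j → Q j ⊆ Q i) →
    (∀ i, Λ i ≠ ∞) → (∀ i, μ (Q i) = 0 → Λ i = 0) → ∀ T : Finset ι,
    ∫⁻ x, (fT μ Q Λ T x) ^ s ∂μ ≤ D * ∑ i ∈ T, Λ i * aT μ Q Λ T i ^ (s - 1) := by
  have hs0 : 0 < s := by linarith
  rcases le_or_gt s 2 with h2 | h2
  · refine ⟨ENNReal.ofReal s, by simpa using hs0, by simp, ?_⟩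
    intro X ι _ μ Q Λ f hm hfin hN hΛ h0 T
    exact fin_A1_le_small hm hfin hN h0 s hs h2 T
  · have hs1 : 0 < s - 1 := by linarith
    refine ⟨ENNReal.ofReal s * ENNReal.ofReal (s-1) ^ (s-1), ?_, ?_, ?_⟩
    · refine mul_ne_zero (by simpa using hs0) ?_
      simp [ENNReal.rpow_eq_zero_iff, hs1.le, hs]
    · exact ENNReal.mul_ne_top (by simp) (ENNReal.rpow_ne_top_of_nonneg hs1.le (by simp))
    intro X ι _ μ Q Λ f hm hfin hN hΛ h0 T
    rw [mul_assoc]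
    exact fin_A1_le_large hm hfin hN hΛ h0 s h2 T

/-- For `1 < s < ∞` there are constants `C₁, C₂, C₃ > 0` depending only on
`s` such that for every locally finite positive Borel measure `σ` on `ℝ^n` and every family
`Λ = (λ_Q)` of nonnegative reals with `λ_Q = 0` whenever `σ(Q) = 0`, one has
`A₁(Λ) ≤ C₁ A₂(Λ) ≤ C₂ A₃(Λ) ≤ C₃ A₁(Λ)`. -/
theorem stmt1 (s : ℝ) (hs : 1 < s) :
    ∃ C₁ C₂ C₃ : ℝ, 0 < C₁ ∧ 0 < C₂ ∧ 0 < C₃ ∧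
      ∀ (n : ℕ), 0 < n → ∀ (σ : Measure (Euc n)), IsLocallyFiniteMeasure σ →
        ∀ (Λ : DIdx n → ℝ≥0), (∀ Q : DIdx n, σ (dCube n Q) = 0 → Λ Q = 0) →
          A1 n σ Λ s ≤ ENNReal.ofReal C₁ * A2 n σ Λ s ∧
          ENNReal.ofReal C₁ * A2 n σ Λ s ≤ ENNReal.ofReal C₂ * A3 n σ Λ s ∧
          ENNReal.ofReal C₂ * A3 n σ Λ s ≤ ENNReal.ofReal C₃ * A1 n σ Λ s := by
  obtain ⟨D1, hD1, hD1', H1⟩ := exists_D1 s hs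
  have hs0 : 0 < s := by linarith
  have hs1 : 0 < s - 1 := by linarith
  have ht : 0 < 1 - 1 / s := by rw [sub_pos, div_lt_one hs0]; exact hs
  set D2 : ℝ≥0∞ := (D1 ^ (1 / s)) ^ (1 / (1 - 1/s)) with hD2def
  set D3 : ℝ≥0∞ := ENNReal.ofReal (s / (s-1)) ^ s with hD3def
  have hD2' : D2 ≠ ∞ := ENNReal.rpow_ne_top_of_nonneg (by positivity)
    (ENNReal.rpow_ne_top_of_nonneg (by positivity) hD1')
  have hD2 : D2 ≠ 0 := by
    rw [hD2def, ← ENNReal.rpow_mul]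
    exact (ENNReal.rpow_pos (pos_iff_ne_zero.2 hD1) hD1').ne'
  have hD3' : D3 ≠ ∞ := ENNReal.rpow_ne_top_of_nonneg hs0.le (by simp)
  have hD3 : D3 ≠ 0 := by
    refine (ENNReal.rpow_pos ?_ (by simp)).ne'
    rw [ENNReal.ofReal_pos]; positivity
  have h12 : D1 * D2 ≠ ∞ := ENNReal.mul_ne_top hD1' hD2'
  have h123 : D1 * D2 * D3 ≠ ∞ := ENNReal.mul_ne_top h12 hD3'
  refine ⟨D1.toReal, (D1 * D2).toReal, (D1 * D2 * D3).toReal, ENNReal.toReal_pos hD1 hD1',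
    ENNReal.toReal_pos (mul_ne_zero hD1 hD2) h12,
    ENNReal.toReal_pos (mul_ne_zero (mul_ne_zero hD1 hD2) hD3) h123, ?_⟩
  intro n hn σ hσ Λ hΛ
  rw [ENNReal.ofReal_toReal hD1', ENNReal.ofReal_toReal h12, ENNReal.ofReal_toReal h123]
  set L : DIdx n → ℝ≥0∞ := fun q => (Λ q : ℝ≥0∞) with hL
  have hm := dCube_meas n
  have hfin := dCube_fin n σ
  have hN : ∀ (i j : DIdx n) x, x ∈ dCube n i → x ∈ dCube n j → i.1 ≤ j.1 →
    dCube n j ⊆ dCube n i := dCube_nest n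
  have hLt : ∀ i, L i ≠ ∞ := fun i => ENNReal.coe_ne_top
  have h0 : ∀ i, σ (dCube n i) = 0 → L i = 0 := fun i hi => by simp [hL, hΛ i hi]
  have e1 : A1 n σ Λ s = ⨆ T, ∫⁻ x, (fT σ (dCube n) L T x) ^ s ∂σ := lim_A1 hm s hs
  have e2 : A2 n σ Λ s = ⨆ T, ∑ i ∈ T, L i * aT σ (dCube n) L T i ^ (s-1) := lim_A2 s hs
  have e3 : A3 n σ Λ s = ⨆ T, ∫⁻ x, (mT (dCube n) (aT σ (dCube n) L T) T x) ^ s ∂σ := lim_A3 hm s hs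
  have F1 := fun T => H1 (f := fun q : DIdx n => q.1) hm hfin hN hLt h0 T
  refine ⟨?_, ?_, ?_⟩
  · rw [e1, e2]
    refine iSup_le fun T => (F1 T).trans ?_
    exact mul_le_mul_right (le_iSup (fun T => ∑ i ∈ T, L i * aT σ (dCube n) L T i ^ (s-1)) T) _
  · rw [e2, e3, mul_assoc]
    refine mul_le_mul_right (iSup_le fun T => ?_) _
    refine (fin_A2_le hm hfin hLt h0 s hs T D1 (F1 T)).trans ?_
    exact mul_le_mul_right
      (le_iSup (fun T => ∫⁻ x, (mT (dCube n) (aT σ (dCube n) L T) T x) ^ s ∂σ) T) _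
  · rw [e1, e3, mul_assoc (D1 * D2)]
    refine mul_le_mul_right (iSup_le fun T => ?_) _
    refine (fin_A3_le (f := fun q : DIdx n => q.1) hm hfin hN hLt h0 s hs T).trans ?_
    exact mul_le_mul_right (le_iSup (fun T => ∫⁻ x, (fT σ (dCube n) L T x) ^ s ∂σ) T) _
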